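/- Let the coefficients satisfy Hypotheses (H) and Hypothesis (C), let G(t,s) be the associated evolution operator, let {μ_t : t ≥ 0} be a tight evolution system of measures for G(t,s), and let μ_∞ be the invariant measure of the semigroup generated by the limit operator A_∞. Then for every s ≥ 0, every p ∈ [1,+∞) and every f ∈ C_b(ℝ^d), the quantity ∫_{ℝ^d} |G(t,s)f − m_s(f)|^p dμ_∞ tends to 0 as t → +∞. -/

import Mathlib

open MeasureTheory Filter Topology Metric Set
open scoped RealInnerProductSpace

noncomputable section

abbrev Ed (d : ℕ) := EuclideanSpace ℝ (Fin d)

/-- `f` belongs to `C_b(ℝ^d)`: it is bounded and continuous. -/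
def IsCb {d : ℕ} (f : Ed d → ℝ) : Prop :=
  Continuous f ∧ ∃ M, ∀ x, |f x| ≤ M

/-- The action of the operator `A(t)φ = Tr(Q(t,·)D²φ) + ⟨b(t,·),∇φ⟩`. -/
def applyA {d : ℕ} (q : ℝ → Ed d → Matrix (Fin d) (Fin d) ℝ) (b : ℝ → Ed d → Ed d)
    (t : ℝ) (u : Ed d → ℝ) (x : Ed d) : ℝ :=
  (∑ i, ∑ j, q t x i j *
      iteratedFDeriv ℝ 2 u x ![EuclideanSpace.single i 1, EuclideanSpace.single j 1]) +
    ⟪b t x, gradient u x⟫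

/-- `u` is a bounded classical solution (in `C_b([s,∞)×ℝ^d) ∩ C^{1,2}((s,∞)×ℝ^d)`)
of `D_t u = A(t)u` on `(s,∞)×ℝ^d` with `u(s,·) = f`. -/
structure IsBoundedClassicalSolution {d : ℕ} (q : ℝ → Ed d → Matrix (Fin d) (Fin d) ℝ)
    (b : ℝ → Ed d → Ed d) (s : ℝ) (f : Ed d → ℝ) (u : ℝ → Ed d → ℝ) : Prop where
  cont : ContinuousOn (fun z : ℝ × Ed d => u z.1 z.2) (Ici s ×ˢ (univ : Set (Ed d)))
  bdd : ∃ M, ∀ t ∈ Ici s, ∀ x, |u t x| ≤ M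
  smooth_space : ∀ t ∈ Ioi s, ContDiff ℝ 2 (u t)
  pde : ∀ t ∈ Ioi s, ∀ x, HasDerivAt (fun τ => u τ x) (applyA q b t (u t) x) t
  init : ∀ x, u s x = f x

/-- Hypotheses (H), together with the associated evolution operator `G(t,s)`. -/
structure Hypotheses (d : ℕ) where
  /-- the Hölder exponent -/
  α : ℝ
  hα : α ∈ Ioo (0:ℝ) 1
  /-- the diffusion coefficients -/
  q : ℝ → Ed d → Matrix (Fin d) (Fin d) ℝ
  /-- the drift coefficients -/
  b : ℝ → Ed d → Ed d
  /-- the ellipticity function -/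
  η : ℝ → Ed d → ℝ
  η₀ : ℝ
  -- (i): local regularity `C^{α/2,1+α}_loc`
  q_diff : ∀ t ∈ Ici (0:ℝ), ∀ i j, Differentiable ℝ fun x => q t x i j
  b_diff : ∀ t ∈ Ici (0:ℝ), Differentiable ℝ (b t)
  q_locHolder : ∀ i j, ∀ T > (0:ℝ), ∀ R > (0:ℝ), ∃ L : ℝ,
    ∀ t ∈ Icc (0:ℝ) T, ∀ s ∈ Icc (0:ℝ) T,
      ∀ x ∈ closedBall (0 : Ed d) R, ∀ y ∈ closedBall (0 : Ed d) R,
        |q t x i j - q s y i j| ≤ L * (|t - s| ^ (α/2) + ‖x - y‖ ^ α) ∧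
        ‖gradient (fun z => q t z i j) x - gradient (fun z => q s z i j) y‖ ≤
          L * (|t - s| ^ (α/2) + ‖x - y‖ ^ α)
  b_locHolder : ∀ i, ∀ T > (0:ℝ), ∀ R > (0:ℝ), ∃ L : ℝ,
    ∀ t ∈ Icc (0:ℝ) T, ∀ s ∈ Icc (0:ℝ) T,
      ∀ x ∈ closedBall (0 : Ed d) R, ∀ y ∈ closedBall (0 : Ed d) R,
        |b t x i - b s y i| ≤ L * (|t - s| ^ (α/2) + ‖x - y‖ ^ α) ∧
        ‖gradient (fun z => b t z i) x - gradient (fun z => b s z i) y‖ ≤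
          L * (|t - s| ^ (α/2) + ‖x - y‖ ^ α)
  -- (i): boundedness on `[0,∞) × B_R` and uniform-in-time `L^p(B_R)` bounds
  q_bdd : ∀ R > (0:ℝ), ∃ M : ℝ, ∀ t ∈ Ici (0:ℝ), ∀ x ∈ ball (0 : Ed d) R, ∀ i j,
    |q t x i j| ≤ M
  q_cont : ∀ R > (0:ℝ), ∀ i j, ContinuousOn (fun z : ℝ × Ed d => q z.1 z.2 i j)
    (Ici (0:ℝ) ×ˢ ball (0 : Ed d) R)
  int_bdd : ∃ p : ℝ, (d : ℝ) + 2 < p ∧ ∀ R > (0:ℝ), ∃ M : ℝ, ∀ t ∈ Ici (0:ℝ), ∀ i j : Fin d,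
    (∫ x in ball (0 : Ed d) R, ‖gradient (fun z => q t z i j) x‖ ^ p) ≤ M ∧
    (∫ x in ball (0 : Ed d) R, |b t x j| ^ p) ≤ M
  -- (ii): symmetry and ellipticity
  q_symm : ∀ t ∈ Ici (0:ℝ), ∀ x, (q t x).IsSymm
  hη₀ : 0 < η₀
  η_lb : ∀ t ∈ Ici (0:ℝ), ∀ x, η₀ ≤ η t x
  ellipticity : ∀ t ∈ Ici (0:ℝ), ∀ x, ∀ ξ : Ed d,
    η t x * ‖ξ‖ ^ 2 ≤ ∑ i, ∑ j, q t x i j * ξ i * ξ j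
  -- (iii): Lyapunov function
  V : Ed d → ℝ
  V_pos : ∀ x, 0 < V x
  V_C2 : ContDiff ℝ 2 V
  V_tendsto : Tendsto V (comap (fun x : Ed d => ‖x‖) atTop) atTop
  a : ℝ
  κ : ℝ
  ha : 0 ≤ a
  hκ : 0 < κ
  lyapunov : ∀ t ∈ Ici (0:ℝ), ∀ x, applyA q b t V x ≤ a - κ * V x
  -- (iv): bounds on the space derivatives of the coefficients
  c₀ : ℝ
  r₀ : ℝ
  hc₀ : 0 ≤ c₀
  gradQ_bdd : ∀ t ∈ Ici (0:ℝ), ∀ x,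
    Real.sqrt (∑ i, ∑ j, ‖gradient (fun z => q t z i j) x‖ ^ 2) ≤ c₀ * η t x
  b_dissip : ∀ t ∈ Ici (0:ℝ), ∀ x, ∀ ξ : Ed d, ⟪fderiv ℝ (b t) x ξ, ξ⟫ ≤ r₀ * ‖ξ‖ ^ 2
  -- (v): growth conditions
  growth : ∃ c > (0:ℝ),
    (∀ t ∈ Ici (0:ℝ), ∀ x,
        Real.sqrt (∑ i, ∑ j, (q t x i j) ^ 2) ≤ c * (1 + ‖x‖) * V x ∧
        ⟪b t x, x⟫ ≤ c * (1 + ‖x‖ ^ 2) * V x) ∨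
    (∀ t ∈ Ici (0:ℝ), ∀ x, Real.sqrt (∑ i, ∑ j, (q t x i j) ^ 2) ≤ c)
  /-- the evolution operator -/
  G : ℝ → ℝ → (Ed d → ℝ) → Ed d → ℝ
  G_sol : ∀ s ∈ Ici (0:ℝ), ∀ f, IsCb f →
    IsBoundedClassicalSolution q b s f fun t => G t s f
  G_unique : ∀ s ∈ Ici (0:ℝ), ∀ f, IsCb f → ∀ u,
    IsBoundedClassicalSolution q b s f u → ∀ t ∈ Ici s, ∀ x, u t x = G t s f x

/-- `{μ_t : t ≥ 0}` is an evolution system of measures for `G(t,s)`. -/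
def IsEvolutionSystem {d : ℕ} (H : Hypotheses d) (μ : ℝ → Measure (Ed d)) : Prop :=
  (∀ t ∈ Ici (0:ℝ), IsProbabilityMeasure (μ t)) ∧
    ∀ f, IsCb f → ∀ s ∈ Ici (0:ℝ), ∀ t ∈ Ici s,
      ∫ x, H.G t s f x ∂μ t = ∫ x, f x ∂μ s

/-- The system `{μ_t : t ≥ 0}` is tight. -/
def IsTightSystem {d : ℕ} (μ : ℝ → Measure (Ed d)) : Prop :=
  ∀ ε > (0:ℝ), ∃ R > (0:ℝ), ∀ t ∈ Ici (0:ℝ),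
    ENNReal.ofReal (1 - ε) ≤ μ t (ball (0 : Ed d) R)

/-- Hypothesis (C): uniform Hölder bounds on balls, pointwise convergence of the
coefficients as `t → +∞`, the limit semigroup `T(t)` generated by `A_∞` and its unique
invariant probability measure `μ∞`. -/
structure HypothesesC {d : ℕ} (H : Hypotheses d) where
  /-- the limiting diffusion coefficients -/
  Qinf : Ed d → Matrix (Fin d) (Fin d) ℝ
  /-- the limiting drift coefficients -/
  binf : Ed d → Ed d
  holder_bdd : ∀ R > (0:ℝ), ∃ L : ℝ,
    ∀ t ∈ Ici (0:ℝ), ∀ s ∈ Ici (0:ℝ), ∀ x ∈ ball (0 : Ed d) R, ∀ y ∈ ball (0 : Ed d) R,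
      (∀ i j, |H.q t x i j - H.q s y i j| ≤ L * (|t - s| ^ (H.α/2) + ‖x - y‖ ^ H.α) ∧
        |H.q t x i j| ≤ L) ∧
      ‖H.b t x - H.b s y‖ ≤ L * (|t - s| ^ (H.α/2) + ‖x - y‖ ^ H.α) ∧ ‖H.b t x‖ ≤ L
  q_conv : ∀ x, ∀ i j, Tendsto (fun t => H.q t x i j) atTop (𝓝 (Qinf x i j))
  b_conv : ∀ x, Tendsto (fun t => H.b t x) atTop (𝓝 (binf x))
  /-- the semigroup generated by the autonomous operator `A_∞` -/
  T : ℝ → (Ed d → ℝ) → Ed d → ℝ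
  T_sol : ∀ f, IsCb f →
    IsBoundedClassicalSolution (fun _ => Qinf) (fun _ => binf) 0 f fun t => T t f
  T_unique : ∀ f, IsCb f → ∀ u,
    IsBoundedClassicalSolution (fun _ => Qinf) (fun _ => binf) 0 f u →
      ∀ t ∈ Ici (0:ℝ), ∀ x, u t x = T t f x
  /-- the invariant measure of `T(t)` -/
  μinf : Measure (Ed d)
  μinf_prob : IsProbabilityMeasure μinf
  μinf_inv : ∀ f, IsCb f → ∀ t ∈ Ici (0:ℝ), ∫ x, T t f x ∂μinf = ∫ x, f x ∂μinf
  μinf_unique : ∀ ν : Measure (Ed d), IsProbabilityMeasure ν →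
    (∀ f, IsCb f → ∀ t ∈ Ici (0:ℝ), ∫ x, T t f x ∂ν = ∫ x, f x ∂ν) → ν = μinf


/-- second derivative as a bilinear form -/
def D2 {d : ℕ} (U : Ed d → ℝ) (x a b : Ed d) : ℝ := fderiv ℝ (fderiv ℝ U) x a b

lemma second_deriv_nonpos {g g' : ℝ → ℝ} {g'' : ℝ} (h1 : ∀ r, HasDerivAt g (g' r) r)
    (h2 : HasDerivAt g' g'' 0) (hmax : IsLocalMax g 0) : g' 0 = 0 ∧ g'' ≤ 0 := by
  have h0 : g' 0 = 0 := hmax.hasDerivAt_eq_zero (h1 0)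
  refine ⟨h0, ?_⟩
  by_contra! hpos
  have hd : deriv g = g' := funext fun r => (h1 r).deriv
  have hmin : IsLocalMin g 0 := by
    apply isLocalMin_of_deriv_deriv_pos
    · rw [hd, h2.deriv]; exact hpos
    · rw [hd, h0]
    · exact (h1 0).continuousAt
  have hc : g =ᶠ[𝓝 0] fun _ => g 0 := by
    filter_upwards [hmax, hmin] with r ha hb
    exact le_antisymm ha hb
  have hc2 : deriv g =ᶠ[𝓝 0] fun _ => 0 := by
    have := hc.deriv
    simpa using this
  rw [hd] at hc2
  have h3 : HasDerivAt g' 0 0 := (hasDerivAt_const (0:ℝ) (0:ℝ)).congr_of_eventuallyEq hc2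
  have := h2.unique h3
  linarith

lemma dir_deriv {d : ℕ} {U : Ed d → ℝ} (hU : ContDiff ℝ 2 U) (x α : Ed d) :
    (∀ r : ℝ, HasDerivAt (fun r : ℝ => U (x + r • α)) (fderiv ℝ U (x + r • α) α) r) ∧
    HasDerivAt (fun r : ℝ => fderiv ℝ U (x + r • α) α) (D2 U x α α) 0 := by
  have hline : ∀ r : ℝ, HasDerivAt (fun r : ℝ => x + r • α) α r := by
    intro r
    simpa using ((hasDerivAt_id r).smul_const α).const_add x
  constructor
  · intro r
    exact ((hU.differentiable (by norm_num)) (x + r • α)).hasFDerivAt.comp_hasDerivAt r (hline r)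
  · have hd : Differentiable ℝ (fderiv ℝ U) :=
      (hU.fderiv_right (m := 1) (by norm_num)).differentiable (by norm_num)
    have h1 := (hd (x + (0:ℝ) • α)).hasFDerivAt.comp_hasDerivAt (0:ℝ) (hline 0)
    have h2 := (ContinuousLinearMap.apply ℝ ℝ α).hasFDerivAt.comp_hasDerivAt (0:ℝ) h1
    simpa [D2, Function.comp_def] using h2

lemma dir_test {d : ℕ} {U W : Ed d → ℝ} (hU : ContDiff ℝ 2 U) (hW : ContDiff ℝ 2 W)
    (x y α β : Ed d) (k A r1 r2 : ℝ)
    (hmax : ∀ᶠ r : ℝ in 𝓝 0, U (x + r • α) - W (y + r • β)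
      + k * Real.exp (-A * (r1 * r + r2 * r ^ 2)) ≤ U x - W y + k) :
    fderiv ℝ U x α - fderiv ℝ W y β = k * A * r1 ∧
    D2 U x α α - D2 W y β β ≤ -k * (A ^ 2 * r1 ^ 2 - 2 * A * r2) := by
  obtain ⟨hU1, hU2⟩ := dir_deriv hU x α
  obtain ⟨hW1, hW2⟩ := dir_deriv hW y β
  have hp : ∀ r : ℝ, HasDerivAt (fun r : ℝ => -A * (r1 * r + r2 * r ^ 2))
      (-A * (r1 + r2 * (2 * r))) r := by
    intro r
    have := (((hasDerivAt_id r).const_mul r1).add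
      (((hasDerivAt_id r).pow 2).const_mul r2)).const_mul (-A)
    simpa using this
  have hp' : HasDerivAt (fun r : ℝ => -A * (r1 + r2 * (2 * r))) (-A * (r2 * 2)) 0 := by
    have := ((((hasDerivAt_id (0:ℝ)).const_mul 2).const_mul r2).const_add r1).const_mul (-A)
    simpa using this
  have h1 : ∀ r : ℝ, HasDerivAt (fun r : ℝ => U (x + r • α) - W (y + r • β)
      + k * Real.exp (-A * (r1 * r + r2 * r ^ 2)))
      (fderiv ℝ U (x + r • α) α - fderiv ℝ W (y + r • β) β +
        k * (Real.exp (-A * (r1 * r + r2 * r ^ 2)) * (-A * (r1 + r2 * (2 * r))))) r := by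
    intro r
    exact ((hU1 r).sub (hW1 r)).add (((hp r).exp).const_mul k)
  have h2 := (hU2.sub hW2).add ((((hp 0).exp).mul hp').const_mul k)
  have h3 := second_deriv_nonpos h1 h2 (by
    filter_upwards [hmax] with r hr
    simpa using hr)
  obtain ⟨h4, h5⟩ := h3
  simp at h4 h5
  constructor <;> linarith

lemma D2_expand {d : ℕ} (U : Ed d → ℝ) (x v : Ed d) :
    ∑ i, ∑ j, (v i * v j) * D2 U x (EuclideanSpace.single i 1) (EuclideanSpace.single j 1)
      = D2 U x v v := by
  have hexp : v = ∑ i, v i • EuclideanSpace.single i (1:ℝ) := by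
    ext j
    simp [Finset.sum_apply, Pi.single_apply]
  conv_rhs => rw [hexp]
  simp only [D2, map_sum, map_smul, sum_apply, smul_apply, smul_eq_mul, Finset.mul_sum]
  rw [Finset.sum_comm]
  refine Finset.sum_congr rfl fun i _ => Finset.sum_congr rfl fun j _ => ?_
  ring

open scoped MatrixOrder Matrix.Norms.L2Operator in
lemma psd_factor {d : ℕ} {M : Matrix (Fin d) (Fin d) ℝ} (hM : M.PosSemidef) :
    ∃ B : Matrix (Fin d) (Fin d) ℝ, M = B.transpose * B := by
  obtain ⟨B, hB⟩ := CStarAlgebra.nonneg_iff_eq_star_mul_self.mp hM.nonneg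
  exact ⟨B, by rw [hB, Matrix.star_eq_conjTranspose, Matrix.conjTranspose_eq_transpose_of_trivial]⟩

lemma psd_decomp {d : ℕ} {M : Matrix (Fin d) (Fin d) ℝ} (hM : M.PosSemidef) :
    ∃ α : Fin d → Ed d, (∀ (U : Ed d → ℝ) (x : Ed d),
      ∑ i, ∑ j, M i j * D2 U x (EuclideanSpace.single i 1) (EuclideanSpace.single j 1)
        = ∑ k, D2 U x (α k) (α k)) ∧ ∑ k, ‖α k‖ ^ 2 = M.trace := by
  obtain ⟨B, rfl⟩ := psd_factor hM
  refine ⟨fun k => WithLp.toLp 2 (B k), ?_, ?_⟩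
  · intro U x
    simp only [← D2_expand, Matrix.mul_apply, Matrix.transpose_apply, Finset.sum_mul]
    rw [Finset.sum_congr rfl fun i _ => Finset.sum_comm, Finset.sum_comm]
  · simp only [EuclideanSpace.norm_sq_eq, Matrix.trace, Matrix.diag, Matrix.mul_apply,
      Matrix.transpose_apply, Real.norm_eq_abs, sq_abs]
    rw [Finset.sum_comm]
    simp [sq]


/-- the coupling distance -/
def rho {d : ℕ} (x y : Ed d) : ℝ := ‖x - y‖ + ‖x‖ ^ 2 + ‖y‖ ^ 2

/-- second order part -/
def trD2 {d : ℕ} (M : Matrix (Fin d) (Fin d) ℝ) (U : Ed d → ℝ) (x : Ed d) : ℝ :=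
  ∑ i, ∑ j, M i j * D2 U x (EuclideanSpace.single i 1) (EuclideanSpace.single j 1)

lemma trD2_add {d : ℕ} (M N : Matrix (Fin d) (Fin d) ℝ) (U : Ed d → ℝ) (x : Ed d) :
    trD2 (M + N) U x = trD2 M U x + trD2 N U x := by
  simp [trD2, add_mul, Finset.sum_add_distrib]

lemma rho_quad {d : ℕ} (x y α β : Ed d) (hxy : x ≠ y) (r : ℝ) :
    rho (x + r • α) (y + r • β) ≤ rho x y +
      ((⟪x - y, α - β⟫ / ‖x - y‖ + 2 * ⟪x, α⟫ + 2 * ⟪y, β⟫) * r +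
       (‖α - β‖ ^ 2 / (2 * ‖x - y‖) + ‖α‖ ^ 2 + ‖β‖ ^ 2) * r ^ 2) := by
  have hz : 0 < ‖x - y‖ := norm_pos_iff.mpr (sub_ne_zero.mpr hxy)
  have e1 : ‖x + r • α‖ ^ 2 = ‖x‖ ^ 2 + 2 * r * ⟪x, α⟫ + r ^ 2 * ‖α‖ ^ 2 := by
    rw [norm_add_sq_real, inner_smul_right, norm_smul, mul_pow, Real.norm_eq_abs, sq_abs]; ring
  have e2 : ‖y + r • β‖ ^ 2 = ‖y‖ ^ 2 + 2 * r * ⟪y, β⟫ + r ^ 2 * ‖β‖ ^ 2 := by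
    rw [norm_add_sq_real, inner_smul_right, norm_smul, mul_pow, Real.norm_eq_abs, sq_abs]; ring
  have e3 : ‖(x + r • α) - (y + r • β)‖ ^ 2 = ‖x - y‖ ^ 2 + 2 * r * ⟪x - y, α - β⟫
      + r ^ 2 * ‖α - β‖ ^ 2 := by
    have : (x + r • α) - (y + r • β) = (x - y) + r • (α - β) := by
      rw [smul_sub]; abel
    rw [this, norm_add_sq_real, inner_smul_right, norm_smul, mul_pow, Real.norm_eq_abs, sq_abs]
    ring
  have e4 : ‖(x + r • α) - (y + r • β)‖ ≤ ‖x - y‖ + ⟪x - y, α - β⟫ / ‖x - y‖ * r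
      + ‖α - β‖ ^ 2 / (2 * ‖x - y‖) * r ^ 2 := by
    set N := ‖(x + r • α) - (y + r • β)‖
    have h1 : 2 * N * ‖x - y‖ ≤ N ^ 2 + ‖x - y‖ ^ 2 := by nlinarith [sq_nonneg (N - ‖x - y‖)]
    have h2 : N ≤ (N ^ 2 + ‖x - y‖ ^ 2) / (2 * ‖x - y‖) := by
      rw [le_div_iff₀ (by positivity)]; linarith
    refine h2.trans (le_of_eq ?_)
    rw [e3]; field_simp; ring
  unfold rho
  rw [e1, e2]
  linarith

lemma rho_refl {d : ℕ} (x y : Ed d) (hxy : x ≠ y) (σ : ℝ) (e : Ed d)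
    (he : e = (1 / ‖x - y‖) • (x - y)) :
    ∀ᶠ r : ℝ in 𝓝 0, rho (x + r • (σ • e)) (y + r • (-(σ • e))) ≤ rho x y +
      ((2 * σ + 2 * σ * ‖x - y‖) * r + (2 * σ ^ 2) * r ^ 2) := by
  have hz : 0 < ‖x - y‖ := norm_pos_iff.mpr (sub_ne_zero.mpr hxy)
  have hne : ‖e‖ = 1 := by
    rw [he, norm_smul]; simp; field_simp
  have hxe : ⟪x, e⟫ - ⟪y, e⟫ = ‖x - y‖ := by
    rw [← inner_sub_left, he, inner_smul_right, real_inner_self_eq_norm_sq]; field_simp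
  have hev : ∀ᶠ r : ℝ in 𝓝 0, 0 < ‖x - y‖ + 2 * σ * r := by
    have : Tendsto (fun r : ℝ => ‖x - y‖ + 2 * σ * r) (𝓝 0) (𝓝 (‖x - y‖ + 2 * σ * 0)) :=
      (Continuous.tendsto (by fun_prop) 0)
    refine this.eventually_const_lt ?_
    simpa using hz
  filter_upwards [hev] with r hr
  have e1 : ‖x + r • (σ • e)‖ ^ 2 = ‖x‖ ^ 2 + 2 * r * σ * ⟪x, e⟫ + r ^ 2 * σ ^ 2 := by
    rw [norm_add_sq_real, inner_smul_right, inner_smul_right, norm_smul, norm_smul, mul_pow,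
      mul_pow, Real.norm_eq_abs, sq_abs, Real.norm_eq_abs, sq_abs, hne]; ring
  have e2 : ‖y + r • (-(σ • e))‖ ^ 2 = ‖y‖ ^ 2 - 2 * r * σ * ⟪y, e⟫ + r ^ 2 * σ ^ 2 := by
    rw [norm_add_sq_real, inner_smul_right, inner_neg_right, inner_smul_right, norm_smul,
      norm_neg, norm_smul, mul_pow,
      mul_pow, Real.norm_eq_abs, sq_abs, Real.norm_eq_abs, sq_abs, hne]; ring
  have e3 : ‖(x + r • (σ • e)) - (y + r • (-(σ • e)))‖ = ‖x - y‖ + 2 * σ * r := by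
    have hxy' : x - y = ‖x - y‖ • e := by
      rw [he, smul_smul]; field_simp; simp
    have : (x + r • (σ • e)) - (y + r • (-(σ • e))) = (‖x - y‖ + 2 * σ * r) • e := by
      have h : (x + r • (σ • e)) - (y + r • (-(σ • e))) = (x - y) + (2 * σ * r) • e := by
        module
      rw [h, add_smul, ← hxy']
    rw [this, norm_smul, hne, Real.norm_eq_abs, abs_of_pos hr, mul_one]
  unfold rho
  rw [e1, e2, e3]
  have : 2 * r * σ * ⟪x, e⟫ = 2 * r * σ * (‖x - y‖ + ⟪y, e⟫) := by rw [← hxe]; ring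
  rw [this]
  apply le_of_eq; ring

lemma coupling_dir {d : ℕ} {U W : Ed d → ℝ} (hU : ContDiff ℝ 2 U) (hW : ContDiff ℝ 2 W)
    (x y : Ed d) (k A : ℝ) (hk : 0 ≤ k) (hA : 0 ≤ A)
    (hmax : ∀ x' y', U x' - W y' + k * Real.exp (-A * (rho x' y' - rho x y)) ≤ U x - W y + k)
    (α β : Ed d) (r1 r2 : ℝ)
    (hr : ∀ᶠ r : ℝ in 𝓝 0, rho (x + r • α) (y + r • β) ≤ rho x y + (r1 * r + r2 * r ^ 2)) :
    fderiv ℝ U x α - fderiv ℝ W y β = k * A * r1 ∧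
    D2 U x α α - D2 W y β β ≤ -k * (A ^ 2 * r1 ^ 2 - 2 * A * r2) := by
  apply dir_test hU hW
  filter_upwards [hr] with r hr
  have h := hmax (x + r • α) (y + r • β)
  have h2 : Real.exp (-A * (r1 * r + r2 * r ^ 2)) ≤
      Real.exp (-A * (rho (x + r • α) (y + r • β) - rho x y)) := by
    apply Real.exp_le_exp.mpr
    nlinarith
  nlinarith [mul_le_mul_of_nonneg_left h2 hk]

lemma coupling_test {d : ℕ} {U W : Ed d → ℝ} (hU : ContDiff ℝ 2 U) (hW : ContDiff ℝ 2 W)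
    (x y : Ed d) (hxy : x ≠ y) (k A : ℝ) (hk : 0 ≤ k) (hA : 0 ≤ A)
    (hmax : ∀ x' y', U x' - W y' + k * Real.exp (-A * (rho x' y' - rho x y)) ≤ U x - W y + k)
    (Q1 Q2 P Qa Qb : Matrix (Fin d) (Fin d) ℝ) (b1 b2 : Ed d) (σ : ℝ) (e : Ed d)
    (he : e = (1 / ‖x - y‖) • (x - y))
    (h1 : Q1 = Qa + P + Matrix.of fun i j => (σ • e) i * (σ • e) j)
    (h2 : Q2 = Qb + P + Matrix.of fun i j => (σ • e) i * (σ • e) j)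
    (hP : P.PosSemidef) (hQa : Qa.PosSemidef) (hQb : Qb.PosSemidef) :
    trD2 Q1 U x - trD2 Q2 W y + (fderiv ℝ U x b1 - fderiv ℝ W y b2) ≤
      -k * (A ^ 2 * (4 * σ ^ 2) - 2 * A * (2 * σ ^ 2 + 2 * P.trace +
        (1 / (2 * ‖x - y‖) + 1) * (Qa.trace + Qb.trace)) -
        A * (⟪x - y, b1 - b2⟫ / ‖x - y‖ + 2 * ⟪x, b1⟫ + 2 * ⟪y, b2⟫)) := by
  have hz : 0 < ‖x - y‖ := norm_pos_iff.mpr (sub_ne_zero.mpr hxy)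
  have key := coupling_dir hU hW x y k A hk hA hmax
  have gen := fun α β => key α β _ _ (Eventually.of_forall (rho_quad x y α β hxy))
  have hb := (gen b1 b2).1
  have hrefl := (key _ _ _ _ (rho_refl x y hxy σ e he)).2
  have drop : ∀ α β : Ed d, D2 U x α α - D2 W y β β ≤
      k * (2 * A * (‖α - β‖ ^ 2 / (2 * ‖x - y‖) + ‖α‖ ^ 2 + ‖β‖ ^ 2)) := by
    intro α β
    have := (gen α β).2
    have h0 : 0 ≤ k * (A ^ 2 * (⟪x - y, α - β⟫ / ‖x - y‖ + 2 * ⟪x, α⟫ + 2 * ⟪y, β⟫) ^ 2) := by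
      positivity
    linarith
  obtain ⟨p, hp1, hp2⟩ := psd_decomp hP
  obtain ⟨a, ha1, ha2⟩ := psd_decomp hQa
  obtain ⟨c, hc1, hc2⟩ := psd_decomp hQb
  have sP : trD2 P U x - trD2 P W y ≤ k * (2 * A * (2 * P.trace)) := by
    unfold trD2
    rw [hp1, hp1, ← Finset.sum_sub_distrib, ← hp2, Finset.mul_sum, Finset.mul_sum, Finset.mul_sum]
    refine Finset.sum_le_sum fun i _ => (drop (p i) (p i)).trans (le_of_eq ?_)
    rw [sub_self, norm_zero]; ring
  have sa : trD2 Qa U x ≤ k * (2 * A * ((1 / (2 * ‖x - y‖) + 1) * Qa.trace)) := by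
    unfold trD2
    rw [ha1, ← ha2, Finset.mul_sum, Finset.mul_sum, Finset.mul_sum]
    refine Finset.sum_le_sum fun i _ => ?_
    have := drop (a i) 0
    simp [D2] at this ⊢
    refine this.trans (le_of_eq ?_)
    ring
  have sb : - trD2 Qb W y ≤ k * (2 * A * ((1 / (2 * ‖x - y‖) + 1) * Qb.trace)) := by
    unfold trD2
    rw [hc1, ← hc2, Finset.mul_sum, Finset.mul_sum, Finset.mul_sum, ← Finset.sum_neg_distrib]
    refine Finset.sum_le_sum fun i _ => ?_
    have := drop 0 (c i)
    simp [D2] at this ⊢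
    refine this.trans (le_of_eq ?_)
    ring
  have hneg : D2 W y (-(σ • e)) (-(σ • e)) = D2 W y (σ • e) (σ • e) := by simp [D2]
  have hr1 : trD2 (Matrix.of fun i j => (σ • e) i * (σ • e) j) U x = D2 U x (σ • e) (σ • e) := by
    rw [← D2_expand]; rfl
  have hr2 : trD2 (Matrix.of fun i j => (σ • e) i * (σ • e) j) W y = D2 W y (σ • e) (σ • e) := by
    rw [← D2_expand]; rfl
  rw [hneg] at hrefl
  have hsq : k * (A ^ 2 * (4 * σ ^ 2)) ≤ k * (A ^ 2 * (2 * σ + 2 * σ * ‖x - y‖) ^ 2) := by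
    gcongr
    nlinarith [mul_nonneg (sq_nonneg σ) hz.le, sq_nonneg (σ * ‖x - y‖)]
  rw [h1, h2]
  simp only [trD2_add, hr1, hr2]
  rw [hb]
  linarith

/-- quadratic form -/
def qf {d : ℕ} (M : Matrix (Fin d) (Fin d) ℝ) (ξ : Ed d) : ℝ := ∑ i, ∑ j, M i j * ξ i * ξ j

lemma qf_add {d : ℕ} (M N : Matrix (Fin d) (Fin d) ℝ) (ξ : Ed d) :
    qf (M + N) ξ = qf M ξ + qf N ξ := by
  simp [qf, add_mul, Finset.sum_add_distrib]

lemma qf_sub {d : ℕ} (M N : Matrix (Fin d) (Fin d) ℝ) (ξ : Ed d) :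
    qf (M - N) ξ = qf M ξ - qf N ξ := by
  simp [qf, sub_mul, Finset.sum_sub_distrib]

lemma qf_scalar {d : ℕ} (c : ℝ) (ξ : Ed d) :
    qf (c • (1 : Matrix (Fin d) (Fin d) ℝ)) ξ = c * ‖ξ‖ ^ 2 := by
  simp [qf, Matrix.one_apply, EuclideanSpace.norm_sq_eq, Finset.mul_sum]
  refine Finset.sum_congr rfl fun i _ => ?_
  ring

lemma qf_rank {d : ℕ} (v ξ : Ed d) :
    qf (Matrix.of fun i j => v i * v j) ξ = ⟪v, ξ⟫ ^ 2 := by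
  have : ⟪v, ξ⟫ = ∑ i, v i * ξ i := by
    simp [PiLp.inner_apply, mul_comm]
  rw [this, sq, Finset.sum_mul_sum]
  simp only [qf, Matrix.of_apply]
  refine Finset.sum_congr rfl fun i _ => Finset.sum_congr rfl fun j _ => ?_
  ring

lemma psd_of_qf {d : ℕ} {M : Matrix (Fin d) (Fin d) ℝ} (hs : M.IsSymm)
    (h : ∀ ξ : Ed d, 0 ≤ qf M ξ) : M.PosSemidef := by
  refine Matrix.PosSemidef.of_dotProduct_mulVec_nonneg ?_ ?_
  · rw [Matrix.IsHermitian, Matrix.conjTranspose_eq_transpose_of_trivial]; exact hs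
  · intro v
    have := h (WithLp.toLp 2 v)
    refine this.trans (le_of_eq ?_)
    simp only [qf, dotProduct, Matrix.mulVec, Finset.mul_sum, Pi.star_apply, star_trivial]
    refine Finset.sum_congr rfl fun i _ => Finset.sum_congr rfl fun j _ => ?_
    ring

lemma qf_small {d : ℕ} {M : Matrix (Fin d) (Fin d) ℝ} {δ : ℝ} (hM : ∀ i j, |M i j| ≤ δ)
    (hδ : 0 ≤ δ) (ξ : Ed d) : |qf M ξ| ≤ d * δ * ‖ξ‖ ^ 2 := by
  have h1 : |qf M ξ| ≤ ∑ i, ∑ j, δ * (|ξ i| * |ξ j|) := by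
    unfold qf
    refine (Finset.abs_sum_le_sum_abs _ _).trans (Finset.sum_le_sum fun i _ => ?_)
    refine (Finset.abs_sum_le_sum_abs _ _).trans (Finset.sum_le_sum fun j _ => ?_)
    rw [abs_mul, abs_mul, mul_assoc]
    exact mul_le_mul_of_nonneg_right (hM i j) (by positivity)
  have h2 : ∑ i, ∑ j, δ * (|ξ i| * |ξ j|) = δ * (∑ i, |ξ i|) ^ 2 := by
    rw [sq, Finset.sum_mul_sum, Finset.mul_sum]
    refine Finset.sum_congr rfl fun i _ => ?_
    rw [Finset.mul_sum]
  have h3 : (∑ i, |ξ i|) ^ 2 ≤ d * ‖ξ‖ ^ 2 := by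
    have := sq_sum_le_card_mul_sum_sq (s := (Finset.univ : Finset (Fin d))) (f := fun i => |ξ i|)
    simpa [EuclideanSpace.norm_sq_eq] using this
  rw [h2] at h1
  nlinarith [mul_le_mul_of_nonneg_left h3 hδ]

lemma trace_le {d : ℕ} {M : Matrix (Fin d) (Fin d) ℝ} {δ : ℝ} (hM : ∀ i j, |M i j| ≤ δ) :
    M.trace ≤ d * δ := by
  unfold Matrix.trace
  calc ∑ i, M.diag i ≤ ∑ i : Fin d, δ :=
        Finset.sum_le_sum fun i _ => (le_abs_self _).trans (hM i i)
    _ = d * δ := by simp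

lemma trace_rank {d : ℕ} (v : Ed d) :
    0 ≤ (Matrix.of fun i j => v i * v j : Matrix (Fin d) (Fin d) ℝ).trace := by
  unfold Matrix.trace
  exact Finset.sum_nonneg fun i _ => by simpa using mul_self_nonneg (v i)

lemma symm_rank {d : ℕ} (v : Ed d) :
    (Matrix.of fun i j => v i * v j : Matrix (Fin d) (Fin d) ℝ).IsSymm := by
  ext i j; simp [mul_comm]

lemma exists_split {d : ℕ} (Q1 Q2 : Matrix (Fin d) (Fin d) ℝ) (hs1 : Q1.IsSymm) (hs2 : Q2.IsSymm)
    (η₀ M ℓ r : ℝ) (hη₀ : 0 < η₀) (hℓ : 0 < ℓ) (hr : 0 < r) (hM0 : 0 ≤ M)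
    (hE1 : ∀ ξ : Ed d, η₀ * ‖ξ‖ ^ 2 ≤ qf Q1 ξ) (hE2 : ∀ ξ : Ed d, η₀ * ‖ξ‖ ^ 2 ≤ qf Q2 ξ)
    (hM1 : ∀ i j, |Q1 i j| ≤ M) (hM2 : ∀ i j, |Q2 i j| ≤ M)
    (hL : ∀ i j, |Q1 i j - Q2 i j| ≤ ℓ * r) (v : Ed d) (hv : ‖v‖ ^ 2 = η₀ / 2) :
    ∃ P Qa Qb : Matrix (Fin d) (Fin d) ℝ, P.PosSemidef ∧ Qa.PosSemidef ∧ Qb.PosSemidef ∧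
      Q1 = Qa + P + (Matrix.of fun i j => v i * v j) ∧
      Q2 = Qb + P + (Matrix.of fun i j => v i * v j) ∧
      P.trace ≤ d * M ∧
      Qa.trace + Qb.trace ≤ ((d + 2 * d ^ 2) * ℓ + 4 * d ^ 2 * M * ℓ / η₀) * r := by
  have hcs : ∀ ξ : Ed d, qf (Matrix.of fun i j => v i * v j) ξ ≤ η₀ / 2 * ‖ξ‖ ^ 2 := by
    intro ξ
    rw [qf_rank, ← hv, ← mul_pow]
    have := abs_real_inner_le_norm v ξ
    rw [← sq_abs]
    gcongr
  have ht := trace_rank v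
  have hsv := symm_rank v
  set N : Matrix (Fin d) (Fin d) ℝ := Matrix.of fun i j => v i * v j with hN
  by_cases hnear : d * (ℓ * r) ≤ η₀ / 2
  · set Λ : ℝ := d * (ℓ * r) with hΛ
    have hΛ0 : 0 ≤ Λ := by positivity
    have hsI : (Λ • (1 : Matrix (Fin d) (Fin d) ℝ)).IsSymm := Matrix.isSymm_one.smul Λ
    refine ⟨Q2 - Λ • 1 - N, Q1 - Q2 + Λ • 1, Λ • 1, ?_, ?_, ?_, ?_, ?_, ?_, ?_⟩
    · refine psd_of_qf ((hs2.sub hsI).sub hsv) fun ξ => ?_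
      rw [qf_sub, qf_sub, qf_scalar]
      have := hE2 ξ
      have := hcs ξ
      nlinarith [sq_nonneg ‖ξ‖]
    · refine psd_of_qf ((hs1.sub hs2).add hsI) fun ξ => ?_
      rw [qf_add, qf_scalar]
      have := (abs_le.mp (qf_small (M := Q1 - Q2) (fun i j => hL i j) (by positivity) ξ)).1
      linarith
    · refine psd_of_qf hsI fun ξ => ?_
      rw [qf_scalar]; positivity
    · abel
    · abel
    · have := trace_le hM2
      have h1 : (0:ℝ) ≤ (Λ • (1 : Matrix (Fin d) (Fin d) ℝ)).trace := by
        simp; positivity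
      rw [Matrix.trace_sub, Matrix.trace_sub]
      linarith
    · have := trace_le (M := Q1 - Q2) (fun i j => hL i j)
      have h1 : (Λ • (1 : Matrix (Fin d) (Fin d) ℝ)).trace = Λ * d := by
        simp
      rw [Matrix.trace_add, h1]
      have h2 : 0 ≤ 4 * d ^ 2 * M * ℓ / η₀ * r := by positivity
      have h3 : Λ * d = d ^ 2 * ℓ * r := by rw [hΛ]; ring
      rw [h3]
      linarith
  · push Not at hnear
    refine ⟨0, Q1 - N, Q2 - N, Matrix.PosSemidef.zero, ?_, ?_, ?_, ?_, ?_, ?_⟩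
    · refine psd_of_qf (hs1.sub hsv) fun ξ => ?_
      rw [qf_sub]
      have := hE1 ξ
      have := hcs ξ
      nlinarith [sq_nonneg ‖ξ‖]
    · refine psd_of_qf (hs2.sub hsv) fun ξ => ?_
      rw [qf_sub]
      have := hE2 ξ
      have := hcs ξ
      nlinarith [sq_nonneg ‖ξ‖]
    · abel
    · abel
    · simp; positivity
    · have h1 := trace_le hM1
      have h2 := trace_le hM2
      rw [Matrix.trace_sub, Matrix.trace_sub]
      have h3 : 2 * (d * M) ≤ 4 * d ^ 2 * M * ℓ / η₀ * r := by
        have : 4 * d ^ 2 * M * ℓ / η₀ * r = 2 * (d * M) * (2 * (d * (ℓ * r)) / η₀) := by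
          field_simp; ring
        rw [this]
        have h4 : 1 ≤ 2 * (d * (ℓ * r)) / η₀ := by
          rw [le_div_iff₀ hη₀]; linarith
        have h5 : (0:ℝ) ≤ 2 * (d * M) := by positivity
        nlinarith
      have h4 : 0 ≤ (d + 2 * d ^ 2) * ℓ * r := by positivity
      linarith

lemma applyA_eq {d : ℕ} (q : ℝ → Ed d → Matrix (Fin d) (Fin d) ℝ) (b : ℝ → Ed d → Ed d)
    (t : ℝ) (u : Ed d → ℝ) (x : Ed d) :
    applyA q b t u x = trD2 (q t x) u x + fderiv ℝ u x (b t x) := by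
  unfold applyA trD2
  congr 1
  · refine Finset.sum_congr rfl fun i _ => Finset.sum_congr rfl fun j _ => ?_
    rw [iteratedFDeriv_two_apply]
    rfl
  · rw [real_inner_comm, gradient, InnerProductSpace.toDual_symm_apply]

lemma applyA_add {d : ℕ} (q : ℝ → Ed d → Matrix (Fin d) (Fin d) ℝ) (b : ℝ → Ed d → Ed d)
    (t : ℝ) {u w : Ed d → ℝ} (hu : ContDiff ℝ 2 u) (hw : ContDiff ℝ 2 w) (c : ℝ) (x : Ed d) :
    applyA q b t (fun z => u z + c * w z) x = applyA q b t u x + c * applyA q b t w x := by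
  have hu1 := hu.differentiable (by norm_num)
  have hw1 := hw.differentiable (by norm_num)
  have h1 : fderiv ℝ (fun z => u z + c * w z) = fun z => fderiv ℝ u z + c • fderiv ℝ w z := by
    funext z
    rw [fderiv_fun_add (hu1 z) ((hw1 z).const_mul c), fderiv_const_mul (hw1 z)]
  have hu2 : Differentiable ℝ (fderiv ℝ u) :=
    (hu.fderiv_right (m := 1) (by norm_num)).differentiable (by norm_num)
  have hw2 : Differentiable ℝ (fderiv ℝ w) :=
    (hw.fderiv_right (m := 1) (by norm_num)).differentiable (by norm_num)
  have h2 : ∀ a b, D2 (fun z => u z + c * w z) x a b = D2 u x a b + c * D2 w x a b := by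
    intro a b
    unfold D2
    rw [h1, fderiv_fun_add (hu2 x) ((hw2 x).fun_const_smul c), fderiv_fun_const_smul (hw2 x)]
    simp
  rw [applyA_eq, applyA_eq, applyA_eq]
  simp only [trD2, h2, h1]
  simp only [mul_add, Finset.sum_add_distrib, add_apply, smul_apply, smul_eq_mul, Finset.mul_sum]
  have : ∀ i j, q t x i j * (c * D2 w x (EuclideanSpace.single i 1) (EuclideanSpace.single j 1))
    = c * (q t x i j * D2 w x (EuclideanSpace.single i 1) (EuclideanSpace.single j 1)) := by
    intro i j; ring
  simp only [this]
  ring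

lemma local_bounds {d : ℕ} (H : Hypotheses d) (HC : HypothesesC H) (R : ℝ) (hR : 0 < R) :
    ∃ K : ℝ, 0 ≤ K ∧ ∀ t ∈ Ici (0:ℝ), ∀ x ∈ ball (0 : Ed d) R, ∀ y ∈ ball (0 : Ed d) R, x ≠ y →
      ∀ e : Ed d, e = (1 / ‖x - y‖) • (x - y) →
      ∃ P Qa Qb : Matrix (Fin d) (Fin d) ℝ, P.PosSemidef ∧ Qa.PosSemidef ∧ Qb.PosSemidef ∧
      H.q t x = Qa + P +
        (Matrix.of fun i j => (√(H.η₀ / 2) • e) i * (√(H.η₀ / 2) • e) j) ∧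
      H.q t y = Qb + P +
        (Matrix.of fun i j => (√(H.η₀ / 2) • e) i * (√(H.η₀ / 2) • e) j) ∧
      2 * (2 * √(H.η₀ / 2) ^ 2 + 2 * P.trace +
        (1 / (2 * ‖x - y‖) + 1) * (Qa.trace + Qb.trace)) +
      (⟪x - y, H.b t x - H.b t y⟫ / ‖x - y‖ + 2 * ⟪x, H.b t x⟫ + 2 * ⟪y, H.b t y⟫) ≤ K := by
  obtain ⟨L, hL⟩ := HC.holder_bdd R hR
  obtain ⟨M0, hM0⟩ := H.q_bdd R hR
  set M := max M0 0 with hMdef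
  have hM : ∀ t ∈ Ici (0:ℝ), ∀ x ∈ ball (0 : Ed d) R, ∀ i j, |H.q t x i j| ≤ M :=
    fun t ht x hx i j => (hM0 t ht x hx i j).trans (le_max_left _ _)
  have hMn : 0 ≤ M := le_max_right _ _
  set ℓ := H.c₀ * M + 1 with hℓdef
  have hc₀ := H.hc₀
  have hη₀ := H.hη₀
  have hℓ : 0 < ℓ := by positivity
  have hLip : ∀ t ∈ Ici (0:ℝ), ∀ x ∈ ball (0 : Ed d) R, ∀ y ∈ ball (0 : Ed d) R, ∀ i j,
      |H.q t x i j - H.q t y i j| ≤ ℓ * ‖x - y‖ := by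
    intro t ht x hx y hy i j
    have := (convex_ball (0 : Ed d) R).norm_image_sub_le_of_norm_fderiv_le (𝕜 := ℝ)
      (f := fun z => H.q t z i j) (C := ℓ) (fun z _ => H.q_diff t ht i j z) ?_ hy hx
    · simpa using this
    · intro z hz
      have h1 : ‖fderiv ℝ (fun z => H.q t z i j) z‖ = ‖gradient (fun z => H.q t z i j) z‖ := by
        rw [gradient, LinearIsometryEquiv.norm_map]
      have h2 := H.gradQ_bdd t ht z
      have h3 : H.η t z ≤ M := by
        have := H.ellipticity t ht z (EuclideanSpace.single i 1)
        have h4 : (∑ i', ∑ j', H.q t z i' j' * (EuclideanSpace.single i (1:ℝ) : Ed d) i' *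
          (EuclideanSpace.single i (1:ℝ) : Ed d) j') = H.q t z i i := by
          simp
        rw [h4] at this
        simp at this
        exact this.trans ((le_abs_self _).trans (hM t ht z hz i i))
      have h5 : ‖gradient (fun z => H.q t z i j) z‖ ≤
          √(∑ i, ∑ j, ‖gradient (fun z => H.q t z i j) z‖ ^ 2) := by
        apply Real.le_sqrt_of_sq_le
        calc ‖gradient (fun z => H.q t z i j) z‖ ^ 2
            ≤ ∑ j, ‖gradient (fun z => H.q t z i j) z‖ ^ 2 :=
              Finset.single_le_sum (f := fun j => ‖gradient (fun z => H.q t z i j) z‖ ^ 2)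
                (fun _ _ => sq_nonneg _) (Finset.mem_univ j)
          _ ≤ _ := Finset.single_le_sum
                (f := fun i => ∑ j, ‖gradient (fun z => H.q t z i j) z‖ ^ 2)
                (fun _ _ => Finset.sum_nonneg fun _ _ => sq_nonneg _) (Finset.mem_univ i)
      rw [h1]
      have := mul_le_mul_of_nonneg_left h3 hc₀
      linarith
  set K1 : ℝ := (d + 2 * d ^ 2) * ℓ + 4 * d ^ 2 * M * ℓ / H.η₀ with hK1
  have hK1n : 0 ≤ K1 := by positivity
  set L' := max L 0 with hL'
  have hL'n : 0 ≤ L' := le_max_right _ _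
  have hbL : ∀ t ∈ Ici (0:ℝ), ∀ x ∈ ball (0 : Ed d) R, ‖H.b t x‖ ≤ L' :=
    fun t ht x hx => ((hL t ht t ht x hx x hx).2.2).trans (le_max_left _ _)
  refine ⟨2 * (2 * (H.η₀ / 2) + 2 * (d * M) + (K1 / 2 + K1 * (2 * R))) +
    (2 * L' + 2 * (R * L') + 2 * (R * L')), by positivity, ?_⟩
  intro t ht x hx y hy hxy e he
  have hz : 0 < ‖x - y‖ := norm_pos_iff.mpr (sub_ne_zero.mpr hxy)
  have hne : ‖e‖ = 1 := by
    rw [he, norm_smul]; simp; field_simp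
  have hσ : √(H.η₀ / 2) ^ 2 = H.η₀ / 2 := Real.sq_sqrt (by positivity)
  have hE : ∀ x, ∀ ξ : Ed d, H.η₀ * ‖ξ‖ ^ 2 ≤ qf (H.q t x) ξ := by
    intro x ξ
    exact (mul_le_mul_of_nonneg_right (H.η_lb t ht x) (sq_nonneg _)).trans
      (H.ellipticity t ht x ξ)
  obtain ⟨P, Qa, Qb, hP, hQa, hQb, e1, e2, t1, t2⟩ := exists_split (H.q t x) (H.q t y)
    (H.q_symm t ht x) (H.q_symm t ht y) H.η₀ M ℓ ‖x - y‖ hη₀ hℓ hz hMn (hE x) (hE y)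
    (hM t ht x hx) (hM t ht y hy) (hLip t ht x hx y hy) (√(H.η₀ / 2) • e)
    (by rw [norm_smul, mul_pow, Real.norm_eq_abs, sq_abs, hσ, hne]; ring)
  refine ⟨P, Qa, Qb, hP, hQa, hQb, e1, e2, ?_⟩
  have hx' : ‖x‖ ≤ R := by simpa using (mem_ball_zero_iff.mp hx).le
  have hy' : ‖y‖ ≤ R := by simpa using (mem_ball_zero_iff.mp hy).le
  have i1 : ⟪x - y, H.b t x - H.b t y⟫ / ‖x - y‖ ≤ 2 * L' := by
    rw [div_le_iff₀ hz]
    have h1 := real_inner_le_norm (x - y) (H.b t x - H.b t y)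
    have h2 := norm_sub_le (H.b t x) (H.b t y)
    have h3 := hbL t ht x hx
    have h4 := hbL t ht y hy
    nlinarith
  have i2 : ⟪x, H.b t x⟫ ≤ R * L' :=
    (real_inner_le_norm _ _).trans (mul_le_mul hx' (hbL t ht x hx) (norm_nonneg _) hR.le)
  have i3 : ⟪y, H.b t y⟫ ≤ R * L' :=
    (real_inner_le_norm _ _).trans (mul_le_mul hy' (hbL t ht y hy) (norm_nonneg _) hR.le)
  have i4 : (1 / (2 * ‖x - y‖) + 1) * (Qa.trace + Qb.trace) ≤ K1 / 2 + K1 * (2 * R) := by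
    have h1 : (1 / (2 * ‖x - y‖) + 1) * (Qa.trace + Qb.trace) ≤
        (1 / (2 * ‖x - y‖) + 1) * (K1 * ‖x - y‖) :=
      mul_le_mul_of_nonneg_left t2 (by positivity)
    have h2 : (1 / (2 * ‖x - y‖) + 1) * (K1 * ‖x - y‖) = K1 / 2 + K1 * ‖x - y‖ := by
      field_simp
    have h3 : ‖x - y‖ ≤ 2 * R := by linarith [norm_sub_le x y]
    have := mul_le_mul_of_nonneg_left h3 hK1n
    linarith
  rw [hσ]
  linarith

lemma V_coercive {d : ℕ} (H : Hypotheses d) (N : ℝ) : ∃ R : ℝ, 0 < R ∧ ∀ x, H.V x ≤ N → ‖x‖ ≤ R := by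
  have h := H.V_tendsto.eventually (eventually_gt_atTop N)
  rw [eventually_comap] at h
  obtain ⟨R, hR⟩ := eventually_atTop.mp h
  refine ⟨max R 1, by positivity, fun x hx => ?_⟩
  by_contra! hlt
  exact absurd (hR ‖x‖ ((le_max_left _ _).trans hlt.le) x rfl) (not_lt.mpr hx)

lemma exists_max {d : ℕ} {u : ℝ → Ed d → ℝ} {s t1 M C lam : ℝ}
    (hcont : ContinuousOn (fun z : ℝ × Ed d => u z.1 z.2) (Ici s ×ˢ (univ : Set (Ed d))))
    (hbd : ∀ t ∈ Ici s, ∀ x, |u t x| ≤ M) (ψ : Ed d → Ed d → ℝ)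
    (hψ : Continuous fun z : Ed d × Ed d => ψ z.1 z.2) (hψ0 : ∀ x y, 0 < ψ x y)
    (hC : 0 < C) (hlam : 0 < lam)
    (hco : ∀ N, ∃ R, ∀ x y, ψ x y ≤ N → ‖x‖ ≤ R ∧ ‖y‖ ≤ R) (hst : s ≤ t1) (x1 y1 : Ed d)
    (hpos : 0 < u t1 x1 - u t1 y1 - C * Real.exp (-lam * (t1 - s)) * ψ x1 y1) :
    ∃ t ∈ Icc s t1, ∃ x y, 0 < u t x - u t y - C * Real.exp (-lam * (t - s)) * ψ x y ∧
      ∀ t' ∈ Icc s t1, ∀ x' y', u t' x' - u t' y' - C * Real.exp (-lam * (t' - s)) * ψ x' y' ≤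
        u t x - u t y - C * Real.exp (-lam * (t - s)) * ψ x y := by
  set c := C * Real.exp (-lam * (t1 - s)) with hc
  have hc0 : 0 < c := by positivity
  obtain ⟨R, hR⟩ := hco (2 * M / c)
  have hin : ∀ t ∈ Icc s t1, ∀ x y, 0 < u t x - u t y - C * Real.exp (-lam * (t - s)) * ψ x y →
      ‖x‖ ≤ R ∧ ‖y‖ ≤ R := by
    intro t ht x y hW
    apply hR
    rw [le_div_iff₀ hc0]
    have h1 := abs_le.mp (hbd t ht.1 x)
    have h2 := abs_le.mp (hbd t ht.1 y)
    have h3 : c ≤ C * Real.exp (-lam * (t - s)) := by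
      rw [hc]
      apply mul_le_mul_of_nonneg_left _ hC.le
      apply Real.exp_le_exp.mpr
      nlinarith [ht.2]
    have := mul_le_mul_of_nonneg_right h3 (hψ0 x y).le
    linarith [h1.1, h1.2, h2.1, h2.2]
  set S : Set (ℝ × Ed d × Ed d) :=
    Icc s t1 ×ˢ (closedBall (0 : Ed d) R ×ˢ closedBall (0 : Ed d) R) with hS
  have hcomp : IsCompact S :=
    isCompact_Icc.prod ((isCompact_closedBall _ _).prod (isCompact_closedBall _ _))
  have hcW : ContinuousOn (fun z : ℝ × Ed d × Ed d => u z.1 z.2.1 - u z.1 z.2.2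
      - C * Real.exp (-lam * (z.1 - s)) * ψ z.2.1 z.2.2) S := by
    refine ContinuousOn.sub (ContinuousOn.sub ?_ ?_) ?_
    · exact hcont.comp (f := fun z : ℝ × Ed d × Ed d => (z.1, z.2.1)) (by fun_prop)
        (fun z hz => ⟨hz.1.1, mem_univ _⟩)
    · exact hcont.comp (f := fun z : ℝ × Ed d × Ed d => (z.1, z.2.2)) (by fun_prop)
        (fun z hz => ⟨hz.1.1, mem_univ _⟩)
    · refine Continuous.continuousOn (Continuous.mul (by fun_prop) ?_)
      exact hψ.comp continuous_snd
  have ht1 : t1 ∈ Icc s t1 := ⟨hst, le_rfl⟩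
  obtain ⟨hx1, hy1⟩ := hin t1 ht1 x1 y1 hpos
  have hmem : (t1, x1, y1) ∈ S := ⟨ht1, by simpa using hx1, by simpa using hy1⟩
  obtain ⟨⟨t, x, y⟩, hz, hmax⟩ := hcomp.exists_isMaxOn ⟨_, hmem⟩ hcW
  have hposm : 0 < u t x - u t y - C * Real.exp (-lam * (t - s)) * ψ x y :=
    lt_of_lt_of_le hpos (hmax hmem)
  refine ⟨t, hz.1, x, y, hposm, ?_⟩
  intro t' ht' x' y'
  by_contra! hlt
  obtain ⟨ha, hb⟩ := hin t' ht' x' y' (hposm.trans hlt)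
  exact absurd (hmax (show (t', x', y') ∈ S from ⟨ht', by simpa using ha, by simpa using hb⟩))
    (not_le.mpr hlt)

lemma deriv_nonneg_of_left_max {g : ℝ → ℝ} {g' s t : ℝ} (hst : s < t) (hg : HasDerivAt g g' t)
    (hmax : ∀ τ ∈ Icc s t, g τ ≤ g t) : 0 ≤ g' := by
  have h1 : IsLocalMaxOn g (Icc s t) t :=
    Filter.eventually_of_mem self_mem_nhdsWithin hmax
  have h2 := h1.hasFDerivWithinAt_nonpos (hg.hasFDerivAt.hasFDerivWithinAt) (y := s - t)
    (sub_mem_posTangentConeAt_of_segment_subset (by rw [segment_symm, segment_eq_Icc hst.le]))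
  simp at h2
  nlinarith

set_option maxHeartbeats 2000000 in
lemma decay {d : ℕ} (H : Hypotheses d) (HC : HypothesesC H) :
    ∃ lam > (0:ℝ), ∃ ε > (0:ℝ), ∃ c2 > (0:ℝ), ∀ s ∈ Ici (0:ℝ), ∀ (f : Ed d → ℝ)
      (u : ℝ → Ed d → ℝ) (M : ℝ), IsBoundedClassicalSolution H.q H.b s f u →
      (∀ t ∈ Ici s, ∀ x, |u t x| ≤ M) → ∀ t ∈ Ici s, ∀ x y,
      u t x - u t y ≤ (2 * M + 1) / c2 * Real.exp (-lam * (t - s)) *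
        (1 + ε * (H.V x + H.V y)) := by
  have hκ := H.hκ
  have ha := H.ha
  have hη₀ := H.hη₀
  have hVc : Continuous H.V := H.V_C2.continuous
  set K1 : ℝ := 4 * H.a / H.κ + 1 with hK1
  have hK1p : 0 < K1 := by positivity
  have hκK1 : H.κ * K1 = 4 * H.a + H.κ := by rw [hK1]; field_simp
  obtain ⟨R1, hR1, hVR1⟩ := V_coercive H K1
  set ρ0 : ℝ := 2 * R1 + 2 * R1 ^ 2 + 1 with hρ0
  have hρ0p : 0 < ρ0 := by positivity
  have hinner : ∀ x y, H.V x + H.V y ≤ K1 → rho x y < ρ0 := by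
    intro x y h
    have hx := hVR1 x (by linarith [H.V_pos y])
    have hy := hVR1 y (by linarith [H.V_pos x])
    have h1 := norm_sub_le x y
    have h2 : ‖x‖ ^ 2 ≤ R1 ^ 2 := by gcongr
    have h3 : ‖y‖ ^ 2 ≤ R1 ^ 2 := by gcongr
    unfold rho
    linarith
  set R : ℝ := ρ0 + 1 with hR
  have hball : ∀ x y : Ed d, rho x y ≤ ρ0 → x ∈ ball (0 : Ed d) R ∧ y ∈ ball (0 : Ed d) R := by
    intro x y h
    unfold rho at h
    have h0 := norm_nonneg (x - y)
    constructor
    · rw [mem_ball_zero_iff]; nlinarith [sq_nonneg ‖y‖, norm_nonneg x]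
    · rw [mem_ball_zero_iff]; nlinarith [sq_nonneg ‖x‖, norm_nonneg y]
  obtain ⟨K, hK0, hK⟩ := local_bounds H HC R (by positivity)
  set A : ℝ := (K + 1) / (2 * H.η₀) with hA
  have hAp : 0 < A := by positivity
  have hAeq : 2 * H.η₀ * A = K + 1 := by rw [hA]; field_simp
  set δ : ℝ := Real.exp (-A * ρ0) with hδ
  have hδp : 0 < δ := Real.exp_pos _
  set c1 : ℝ := A * δ with hc1
  have hc1p : 0 < c1 := by positivity
  obtain ⟨B, hB⟩ : ∃ B : ℝ, ∀ x ∈ closedBall (0 : Ed d) R, H.V x ≤ B := by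
    obtain ⟨B, hB⟩ := ((isCompact_closedBall (0 : Ed d) R).image hVc).bddAbove
    exact ⟨B, fun x hx => hB (mem_image_of_mem _ hx)⟩
  have hBp : 0 < B := lt_of_lt_of_le (H.V_pos 0) (hB 0 (by simp; positivity))
  set ε : ℝ := c1 / (4 * (H.a + 1)) with hε
  have hεp : 0 < ε := by positivity
  have hεa : 2 * H.a * ε ≤ c1 / 2 := by
    have : 4 * (H.a + 1) * ε = c1 := by rw [hε]; field_simp
    nlinarith
  set lam : ℝ := min (H.κ / 4) (min (ε * H.κ * K1 / 8) (c1 / (4 * (1 + 2 * ε * B)))) with hlam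
  have hlamp : 0 < lam := by
    rw [hlam]; exact lt_min (by positivity) (lt_min (by positivity) (by positivity))
  have hl1 : lam ≤ H.κ / 4 := min_le_left _ _
  have hl2 : lam ≤ ε * H.κ * K1 / 8 := (min_le_right _ _).trans (min_le_left _ _)
  have hl3 : lam * (1 + 2 * ε * B) ≤ c1 / 4 := by
    have h : lam ≤ c1 / (4 * (1 + 2 * ε * B)) := (min_le_right _ _).trans (min_le_right _ _)
    rw [le_div_iff₀ (by positivity)] at h
    linarith
  set ψ : Ed d → Ed d → ℝ := fun x y => 1 + ε * (H.V x + H.V y) -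
    max 0 (Real.exp (-A * rho x y) - δ) with hψ
  have hrhoc : Continuous fun z : Ed d × Ed d => rho z.1 z.2 := by
    unfold rho; fun_prop
  have hψc : Continuous fun z : Ed d × Ed d => ψ z.1 z.2 := by
    simp only [hψ]
    refine Continuous.sub (by fun_prop) (Continuous.max continuous_const ?_)
    exact (Real.continuous_exp.comp (hrhoc.const_mul (-A))).sub continuous_const
  have hrho0 : ∀ x y : Ed d, 0 ≤ rho x y := fun x y => by unfold rho; positivity
  have hδ1 : δ ≤ 1 := by
    rw [hδ, Real.exp_le_one_iff]; nlinarith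
  have hmaxle : ∀ x y : Ed d, max 0 (Real.exp (-A * rho x y) - δ) ≤ 1 - δ := by
    intro x y
    apply max_le (by linarith)
    have : Real.exp (-A * rho x y) ≤ 1 := by
      rw [Real.exp_le_one_iff]; nlinarith [hrho0 x y]
    linarith
  have hψlow : ∀ x y, δ + ε * (H.V x + H.V y) ≤ ψ x y := by
    intro x y
    have := hmaxle x y
    simp only [hψ]; linarith
  have hψup : ∀ x y, ψ x y ≤ 1 + ε * (H.V x + H.V y) := by
    intro x y
    have := le_max_left 0 (Real.exp (-A * rho x y) - δ)
    simp only [hψ]; linarith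
  have hψδ : ∀ x y, δ < ψ x y := by
    intro x y
    have := hψlow x y
    have h2 : 0 < ε * (H.V x + H.V y) := mul_pos hεp (add_pos (H.V_pos x) (H.V_pos y))
    linarith
  refine ⟨lam, hlamp, ε, hεp, δ, hδp, ?_⟩
  intro s hs f u M hu hbd t1 ht1 x1 y1
  have hM : 0 ≤ M := (abs_nonneg _).trans (hbd s (self_mem_Ici) 0)
  set C : ℝ := (2 * M + 1) / δ with hC
  have hCp : 0 < C := by positivity
  suffices hmain : u t1 x1 - u t1 y1 ≤ C * Real.exp (-lam * (t1 - s)) * ψ x1 y1 by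
    refine hmain.trans (mul_le_mul_of_nonneg_left (hψup x1 y1) (by positivity))
  by_contra! hcon
  have hcoer : ∀ N, ∃ R, ∀ x y, ψ x y ≤ N → ‖x‖ ≤ R ∧ ‖y‖ ≤ R := by
    intro N
    obtain ⟨R', _, hR'⟩ := V_coercive H (N / ε)
    refine ⟨R', fun x y h => ?_⟩
    have h1 := hψlow x y
    have hx := H.V_pos x
    have hy := H.V_pos y
    constructor
    · apply hR'
      rw [le_div_iff₀ hεp]; nlinarith
    · apply hR'
      rw [le_div_iff₀ hεp]; nlinarith
  obtain ⟨t, ht, x, y, hpos, hmax⟩ := exists_max hu.cont hbd ψ hψc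
    (fun x y => hδp.trans (hψδ x y)) hCp hlamp hcoer ht1 x1 y1 (by linarith)
  have hxy : x ≠ y := by
    rintro rfl
    have : 0 < C * Real.exp (-lam * (t - s)) * ψ x x :=
      mul_pos (by positivity) (hδp.trans (hψδ x x))
    linarith
  have hts : s < t := by
    rcases ht.1.lt_or_eq with h | h
    · exact h
    · exfalso
      rw [← h] at hpos
      simp only [sub_self, mul_zero, Real.exp_zero, mul_one] at hpos
      have h1 := abs_le.mp (hbd s self_mem_Ici x)
      have h2 := abs_le.mp (hbd s self_mem_Ici y)
      have h3 : C * δ = 2 * M + 1 := by rw [hC]; field_simp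
      have h4 := mul_lt_mul_of_pos_left (hψδ x y) hCp
      linarith [h1.1, h1.2, h2.1, h2.2]
  have ht0 : t ∈ Ici (0:ℝ) := le_trans (mem_Ici.mp hs) hts.le
  set c : ℝ := C * Real.exp (-lam * (t - s)) with hc
  have hcp : 0 < c := by positivity
  -- time derivative
  have htime : 0 ≤ applyA H.q H.b t (u t) x - applyA H.q H.b t (u t) y + lam * c * ψ x y := by
    have hE : HasDerivAt (fun τ : ℝ => C * Real.exp (-lam * (τ - s)) * ψ x y)
        (C * (Real.exp (-lam * (t - s)) * (-lam)) * ψ x y) t := by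
      have h1 : HasDerivAt (fun τ : ℝ => -lam * (τ - s)) (-lam) t := by
        simpa using ((hasDerivAt_id t).sub_const s).const_mul (-lam)
      exact (h1.exp.const_mul C).mul_const _
    have := deriv_nonneg_of_left_max hts (((hu.pde t hts x).sub (hu.pde t hts y)).sub hE)
      (fun τ hτ => hmax τ ⟨hτ.1, hτ.2.trans ht.2⟩ x y)
    refine this.trans (le_of_eq ?_)
    rw [hc]; ring
  have hspace : ∀ x' y', u t x' - u t y' - c * ψ x' y' ≤ u t x - u t y - c * ψ x y :=
    fun x' y' => hmax t ht x' y'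
  have huC : ContDiff ℝ 2 (u t) := hu.smooth_space t hts
  set U : Ed d → ℝ := fun z => u t z + (-(c * ε)) * H.V z with hU
  set W : Ed d → ℝ := fun z => u t z + (c * ε) * H.V z with hW
  have hUC : ContDiff ℝ 2 U := huC.add (contDiff_const.mul H.V_C2)
  have hWC : ContDiff ℝ 2 W := huC.add (contDiff_const.mul H.V_C2)
  have hAU : applyA H.q H.b t U x = _ := applyA_add H.q H.b t huC H.V_C2 (-(c * ε)) x
  have hAW : applyA H.q H.b t W y = _ := applyA_add H.q H.b t huC H.V_C2 (c * ε) y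
  have hVx := H.lyapunov t ht0 x
  have hVy := H.lyapunov t ht0 y
  have hcε : 0 < c * ε := by positivity
  have hVx' := mul_le_mul_of_nonneg_left hVx hcε.le
  have hVy' := mul_le_mul_of_nonneg_left hVy hcε.le
  have hSp : 0 < H.V x + H.V y := add_pos (H.V_pos x) (H.V_pos y)
  rcases le_or_gt ρ0 (rho x y) with hcase | hcase
  · -- outer region
    have hψ1 : ψ x y = 1 + ε * (H.V x + H.V y) := by
      have : Real.exp (-A * rho x y) ≤ δ := by
        rw [hδ]; apply Real.exp_le_exp.mpr; nlinarith
      simp only [hψ]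
      rw [max_eq_left (by linarith)]; ring
    have hS : K1 < H.V x + H.V y := by
      by_contra! h
      exact absurd (hinner x y h) (not_lt.mpr hcase)
    have hPSD : ∀ z, (H.q t z).PosSemidef := fun z => psd_of_qf (H.q_symm t ht0 z) fun ξ =>
      le_trans (mul_nonneg (hη₀.le.trans (H.η_lb t ht0 z)) (sq_nonneg _)) (H.ellipticity t ht0 z ξ)
    have hz0 : ∀ v : Ed d, (Matrix.of fun i j => ((0:ℝ) • v) i * ((0:ℝ) • v) j)
        = (0 : Matrix (Fin d) (Fin d) ℝ) := by
      intro v; ext i j; simp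
    have hct := coupling_test hUC hWC x y hxy 0 A le_rfl hAp.le (by
      intro x' y'
      have h1 := hspace x' y'
      have h2 := mul_le_mul_of_nonneg_left (hψup x' y') hcp.le
      rw [hψ1] at h1
      simp only [hU, hW, zero_mul, add_zero]
      linarith) (H.q t x) (H.q t y) 0 (H.q t x) (H.q t y) (H.b t x) (H.b t y) 0 _ rfl
      (by rw [hz0]; simp) (by rw [hz0]; simp) Matrix.PosSemidef.zero (hPSD x) (hPSD y)
    have hle : applyA H.q H.b t U x - applyA H.q H.b t W y ≤ 0 := by
      rw [applyA_eq, applyA_eq]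
      simp only [neg_zero, zero_mul] at hct
      linarith
    rw [hAU, hAW] at hle
    rw [hψ1] at htime
    set S := H.V x + H.V y with hSdef
    have f1 : 0 ≤ c * (ε * (2 * H.a - H.κ * S) + lam * (1 + ε * S)) := by
      have h1 : c * (ε * (2 * H.a - H.κ * S) + lam * (1 + ε * S)) =
          c * ε * (H.a - H.κ * H.V x) + c * ε * (H.a - H.κ * H.V y) +
          lam * c * (1 + ε * S) := by rw [hSdef]; ring
      rw [h1]
      linarith
    have f2 : 0 ≤ ε * (2 * H.a - H.κ * S) + lam * (1 + ε * S) := nonneg_of_mul_nonneg_right f1 hcp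
    have f3 : 2 * H.a ≤ H.κ * S / 2 := by nlinarith
    have f4 : ε * (2 * H.a - H.κ * S) ≤ ε * (-(H.κ * S / 2)) :=
      mul_le_mul_of_nonneg_left (by linarith) hεp.le
    have f5 : lam * (ε * S) ≤ H.κ / 4 * (ε * S) :=
      mul_le_mul_of_nonneg_right hl1 (by positivity)
    have f6 : ε * H.κ * K1 < ε * H.κ * S := mul_lt_mul_of_pos_left hS (by positivity)
    have f7 : 0 < ε * H.κ * S := by positivity
    linarith
  · -- inner region
    obtain ⟨hxb, hyb⟩ := hball x y hcase.le
    have hexpδ : δ ≤ Real.exp (-A * rho x y) := by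
      rw [hδ]; apply Real.exp_le_exp.mpr; nlinarith
    have hψ2 : ψ x y = 1 + ε * (H.V x + H.V y) - (Real.exp (-A * rho x y) - δ) := by
      simp only [hψ]
      rw [max_eq_right (by linarith)]
    obtain ⟨P, Qa, Qb, hP, hQa, hQb, e1, e2, hbound⟩ := hK t ht0 x hxb y hyb hxy _ rfl
    set k : ℝ := c * Real.exp (-A * rho x y) with hk
    have hkp : 0 < k := by positivity
    have hct := coupling_test hUC hWC x y hxy k A hkp.le hAp.le (by
      intro x' y'
      have h1 := hspace x' y'
      have h2 : ψ x' y' ≤ 1 + ε * (H.V x' + H.V y') - (Real.exp (-A * rho x' y') - δ) := by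
        have := le_max_right 0 (Real.exp (-A * rho x' y') - δ)
        simp only [hψ]; linarith
      have h2' := mul_le_mul_of_nonneg_left h2 hcp.le
      rw [hψ2] at h1
      have h3 : k * Real.exp (-A * (rho x' y' - rho x y)) = c * Real.exp (-A * rho x' y') := by
        rw [hk, mul_assoc, ← Real.exp_add]; congr 2; ring
      rw [h3]
      simp only [hU, hW, hk]
      linarith) (H.q t x) (H.q t y) P Qa Qb (H.b t x) (H.b t y) _ _ rfl e1 e2 hP hQa hQb
    have hσ : √(H.η₀ / 2) ^ 2 = H.η₀ / 2 := Real.sq_sqrt (by positivity)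
    have hle : applyA H.q H.b t U x - applyA H.q H.b t W y ≤ -(k * A) := by
      rw [applyA_eq, applyA_eq]
      have g1 := mul_le_mul_of_nonneg_left hbound (mul_pos hkp hAp).le
      have g2 : k * (A ^ 2 * (4 * √(H.η₀ / 2) ^ 2)) = k * A * (K + 1) := by
        rw [hσ, ← hAeq]; ring
      linarith
    rw [hAU, hAW] at hle
    have g3 : c * c1 ≤ k * A := by
      rw [hk, hc1]
      have := mul_le_mul_of_nonneg_left hexpδ (mul_pos hcp hAp).le
      linarith
    have g4 : ψ x y ≤ 1 + 2 * ε * B := by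
      have h1 := hψup x y
      have h2 := mul_le_mul_of_nonneg_left (hB x (ball_subset_closedBall hxb)) hεp.le
      have h3 := mul_le_mul_of_nonneg_left (hB y (ball_subset_closedBall hyb)) hεp.le
      linarith
    have g5 : lam * c * ψ x y ≤ c * (c1 / 4) := by
      have h1 := mul_le_mul_of_nonneg_left g4 (mul_pos hlamp hcp).le
      have h2 := mul_le_mul_of_nonneg_left hl3 hcp.le
      linarith
    have g6 := mul_le_mul_of_nonneg_left hεa hcp.le
    have g7 : 0 < c * c1 := by positivity
    have g8 : 0 < c * ε * (H.κ * H.V x) :=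
      mul_pos hcε (mul_pos hκ (H.V_pos x))
    have g9 : 0 < c * ε * (H.κ * H.V y) :=
      mul_pos hcε (mul_pos hκ (H.V_pos y))
    linarith

lemma pointwise_conv {d : ℕ} (H : Hypotheses d) (HC : HypothesesC H)
    (μ : ℝ → Measure (Ed d)) (hsys : IsEvolutionSystem H μ) (htight : IsTightSystem μ)
    (s : ℝ) (hs : 0 ≤ s) (f : Ed d → ℝ) (hf : IsCb f) (x : Ed d) :
    Tendsto (fun t => H.G t s f x) atTop (𝓝 (∫ y, f y ∂μ s)) := by
  have hsol := H.G_sol s hs f hf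
  obtain ⟨M, hM⟩ := hsol.bdd
  have hM0 : 0 ≤ M := (abs_nonneg _).trans (hM s self_mem_Ici 0)
  obtain ⟨lam, hlam, ε, hε, c2, hc2, hdec⟩ := decay H HC
  have hd := hdec s hs f _ M hsol hM
  have hcont : ∀ t ∈ Ici s, Continuous (H.G t s f) := by
    intro t ht
    have := hsol.cont.comp (f := fun y : Ed d => (t, y)) (s := univ) (by fun_prop)
      (fun y _ => ⟨ht, mem_univ _⟩)
    exact continuousOn_univ.mp this
  rw [Metric.tendsto_atTop']
  intro δ hδ
  set ε' : ℝ := δ / (4 * (M + 1)) with hε'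
  have hε'p : 0 < ε' := by positivity
  obtain ⟨R, hR, hRt⟩ := htight ε' hε'p
  obtain ⟨B, hB⟩ : ∃ B : ℝ, ∀ y ∈ closedBall (0 : Ed d) R, H.V y ≤ B := by
    obtain ⟨B, hB⟩ := ((isCompact_closedBall (0 : Ed d) R).image H.V_C2.continuous).bddAbove
    exact ⟨B, fun x hx => hB (mem_image_of_mem _ hx)⟩
  set D : ℝ → ℝ := fun t => (2 * M + 1) / c2 * Real.exp (-lam * (t - s)) *
    (1 + ε * (H.V x + B)) with hD
  have hDlim : Tendsto D atTop (𝓝 0) := by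
    have h1 : Tendsto (fun t : ℝ => -lam * (t - s)) atTop atBot := by
      have : Tendsto (fun t : ℝ => t - s) atTop atTop := tendsto_atTop_add_const_right _ (-s) tendsto_id
      exact this.const_mul_atTop_of_neg (by linarith)
    have h2 := ((Real.tendsto_exp_atBot.comp h1).const_mul ((2 * M + 1) / c2)).mul_const
      (1 + ε * (H.V x + B))
    rw [mul_zero, zero_mul] at h2
    exact h2
  obtain ⟨T, hT⟩ := eventually_atTop.mp (hDlim.eventually_lt_const (show (0:ℝ) < δ / 2 by positivity))
  refine ⟨max T s, fun t ht => ?_⟩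
  have htT : T ≤ t := (le_max_left _ _).trans (le_of_lt ht)
  have hts : t ∈ Ici s := (le_max_right T s).trans (le_of_lt ht)
  have ht0 : t ∈ Ici (0:ℝ) := hs.trans hts
  haveI := hsys.1 t ht0
  have hm : ∫ y, f y ∂μ s = ∫ y, H.G t s f y ∂μ t := (hsys.2 f hf s hs t hts).symm
  have hint : Integrable (H.G t s f) (μ t) :=
    Integrable.of_bound (hcont t hts).aestronglyMeasurable M
      (Eventually.of_forall fun y => by simpa using hM t hts y)
  have hdiff : H.G t s f x - ∫ y, f y ∂μ s = ∫ y, (H.G t s f x - H.G t s f y) ∂μ t := by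
    rw [hm, integral_sub (integrable_const _) hint]; simp
  have hmeas : MeasurableSet (ball (0 : Ed d) R)ᶜ := measurableSet_ball.compl
  have hDn : 0 ≤ D t := by
    have h0 := H.V_pos x
    have h1 := (H.V_pos 0).le.trans (hB 0 (by simp; positivity))
    simp only [hD]; positivity
  have hpt : ∀ y, ‖H.G t s f x - H.G t s f y‖ ≤
      D t + (ball (0 : Ed d) R)ᶜ.indicator (fun _ => 2 * M) y := by
    intro y
    by_cases hy : y ∈ ball (0 : Ed d) R
    · have h1 := hd t hts x y
      have h2 := hd t hts y x
      rw [indicator_of_notMem (by simpa using hy), add_zero, Real.norm_eq_abs, abs_le]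
      have h3 : (2 * M + 1) / c2 * Real.exp (-lam * (t - s)) * (1 + ε * (H.V x + H.V y)) ≤ D t := by
        simp only [hD]
        have := hB y (ball_subset_closedBall hy)
        gcongr
      rw [add_comm (H.V y)] at h2
      constructor <;> linarith
    · rw [indicator_of_mem (by simpa using hy), Real.norm_eq_abs, abs_le]
      have h1 := abs_le.mp (hM t hts x)
      have h2 := abs_le.mp (hM t hts y)
      constructor <;> linarith [h1.1, h1.2, h2.1, h2.2]
  have hμc : (μ t).real (ball (0 : Ed d) R)ᶜ ≤ ε' := by
    rw [probReal_compl_eq_one_sub measurableSet_ball]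
    have h1 : 1 - ε' ≤ (μ t).real (ball (0 : Ed d) R) := by
      rw [measureReal_def]
      exact (ENNReal.ofReal_le_iff_le_toReal (measure_ne_top _ _)).mp (hRt t ht0)
    linarith
  have hbound : ‖∫ y, (H.G t s f x - H.G t s f y) ∂μ t‖ ≤ D t + 2 * M * ε' := by
    have hind : Integrable ((ball (0 : Ed d) R)ᶜ.indicator (fun _ => 2 * M)) (μ t) :=
      (integrable_const _).indicator hmeas
    refine (norm_integral_le_of_norm_le ((integrable_const (D t)).add hind)
      (Eventually.of_forall hpt)).trans ?_
    rw [integral_add' (integrable_const _) hind, integral_indicator_const _ hmeas]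
    simp only [integral_const, probReal_univ, one_smul, smul_eq_mul]
    have := mul_le_mul_of_nonneg_left hμc (show 0 ≤ 2 * M by positivity)
    linarith
  rw [Real.dist_eq, hdiff, ← Real.norm_eq_abs]
  have h1 := hT t htT
  have h2 : 4 * (M + 1) * ε' = δ := by rw [hε']; field_simp
  nlinarith

/-- Under Hypotheses (H) and (C), for every `s ≥ 0`, `p ∈ [1,∞)` and
`f ∈ C_b(ℝ^d)`, `∫ |G(t,s)f − m_s(f)|^p dμ_∞ → 0` as `t → +∞`. -/
theorem convergence_in_Lp_muinf (d : ℕ) (H : Hypotheses d) (HC : HypothesesC H)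
    (μ : ℝ → Measure (Ed d)) (hsys : IsEvolutionSystem H μ) (htight : IsTightSystem μ)
    (s : ℝ) (hs : 0 ≤ s) (p : ℝ) (hp : 1 ≤ p) (f : Ed d → ℝ) (hf : IsCb f) :
    Tendsto (fun t => ∫ x, |H.G t s f x - ∫ y, f y ∂μ s| ^ p ∂HC.μinf) atTop (𝓝 0) := by
  have hsol := H.G_sol s hs f hf
  obtain ⟨M, hM⟩ := hsol.bdd
  haveI := HC.μinf_prob
  have hp0 : 0 < p := by linarith
  set m := ∫ y, f y ∂μ s with hm
  have hcont : ∀ t ∈ Ici s, Continuous (H.G t s f) := by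
    intro t ht
    have := hsol.cont.comp (f := fun y : Ed d => (t, y)) (s := univ) (by fun_prop)
      (fun y _ => ⟨ht, mem_univ _⟩)
    exact continuousOn_univ.mp this
  have key := tendsto_integral_filter_of_dominated_convergence (μ := HC.μinf) (l := atTop)
    (F := fun t x => |H.G t s f x - m| ^ p) (f := fun _ => (0:ℝ)) (fun _ => (M + |m|) ^ p)
    ?_ ?_ (integrable_const _) ?_
  · simpa using key
  · filter_upwards [eventually_ge_atTop s] with t ht
    have h1 := ((hcont t ht).sub continuous_const).abs (f := fun x => H.G t s f x - m)
    exact (h1.rpow_const fun x => Or.inr hp0.le).aestronglyMeasurable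
  · filter_upwards [eventually_ge_atTop s] with t ht
    refine Eventually.of_forall fun x => ?_
    rw [Real.norm_eq_abs, abs_of_nonneg (Real.rpow_nonneg (abs_nonneg _) _)]
    apply Real.rpow_le_rpow (abs_nonneg _) _ hp0.le
    have h1 := abs_sub (H.G t s f x) m
    have h2 := hM t ht x
    linarith
  · refine Eventually.of_forall fun x => ?_
    have h1 := pointwise_conv H HC μ hsys htight s hs f hf x
    have h2 : Tendsto (fun t => |H.G t s f x - m|) atTop (𝓝 0) := by
      have := (h1.sub_const m).abs
      simpa [hm] using this
    have h3 := h2.rpow_const (p := p) (Or.inr hp0.le)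
    rwa [Real.zero_rpow hp0.ne'] at h3
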